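/- arXiv:1311.1803 — 10 statements merged into one kernel-verified Lean document; each statement's English description precedes it below -/
import Mathlib

section
/- In any load balancing game with m ≥ 3 identical servers, every Nash equilibrium assignment is a 5/4-approximate strong Nash equilibrium: for every NE assignment σ and every coalitional deviation σ′ from σ, some coalition job j satisfies L_σ(σ(j)) ≤ (5/4)·L_{σ′}(σ′(j)). -/
/-- The workload of server `i` under assignment `σ`: total processing time
of the jobs assigned to `i`. -/
def load {n m : ℕ} (p : Fin n → ℝ) (σ : Fin n → Fin m) (i : Fin m) : ℝ :=
  ∑ j ∈ Finset.univ.filter (fun j => σ j = i), p j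

/-- `σ` is a Nash equilibrium assignment. -/
def IsNE {n m : ℕ} (p : Fin n → ℝ) (σ : Fin n → Fin m) : Prop :=
  ∀ j i, load p σ (σ j) ≤ load p σ i + p j

/-- `σ'` is a coalitional deviation from `σ`: the coalition
`{j : σ' j ≠ σ j}` is nonempty and every coalition job strictly improves. -/
def IsDeviation {n m : ℕ} (p : Fin n → ℝ) (σ σ' : Fin n → Fin m) : Prop :=
  (∃ j, σ' j ≠ σ j) ∧ ∀ j, σ' j ≠ σ j → load p σ' (σ' j) < load p σ (σ j)

/-- Bound on the total charge of a server all of whose jobs leave. -/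
lemma charge_le_of_emptied {a L X c : ℝ} (ha : 0 < a) (haL : a ≤ L) (hc : 0 ≤ c) (hX : 0 ≤ X)
    (h : X + c * (L - a) ≤ L) :
    a - L + (X * (1 - a / L) + c * (4 / 5 * L - a)) ≤ a / 5 := by
  have hL : 0 < L := ha.trans_le haL
  have key : c * (a * L - L ^ 2 / 5 - a ^ 2) ≤ a * L / 5 := by
    rcases le_or_gt (a * L - L ^ 2 / 5 - a ^ 2) 0 with hq | hq
    · have := mul_nonneg hc (neg_nonneg.2 hq)
      have := mul_pos ha hL
      linarith
    · have hlt : a < L := by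
        rcases haL.lt_or_eq with h' | h'
        · exact h'
        · subst h'
          nlinarith
      have h1 : c * (L - a) ≤ L := by linarith
      have h2 := mul_le_mul_of_nonneg_right h1 hq.le
      have h3 : L * (a * L - L ^ 2 / 5 - a ^ 2) ≤ L * (a * (L - a) / 5) :=
        mul_le_mul_of_nonneg_left (by nlinarith [sq_nonneg (L - 2 * a)]) hL.le
      refine le_of_mul_le_mul_right ?_ (sub_pos.2 hlt)
      linarith
  have h4 := mul_le_mul_of_nonneg_left h (sub_nonneg.2 haL)
  have h5 : (a - L + (X * (1 - a / L) + c * (4 / 5 * L - a))) * L ≤ a / 5 * L := by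
    have : X * (1 - a / L) * L = X * (L - a) := by field_simp
    linarith
  exact le_of_mul_le_mul_right h5 hL

/-- Bound on the total charge of a server that keeps at least one job. -/
lemma charge_le_of_kept {a L X c : ℝ} (ha : 0 < a) (haL : a ≤ L) (hc : 0 ≤ c) (hX : 0 ≤ X)
    (h : (L - a) + X + c * (L - a) ≤ L) :
    a - L + (X * (1 - a / L) + c * (4 / 5 * L - a)) ≤ 0 := by
  have hL : 0 < L := ha.trans_le haL
  have key : c * (a * L - L ^ 2 / 5 - a ^ 2) ≤ (L - a) ^ 2 := by
    rcases le_or_gt (a * L - L ^ 2 / 5 - a ^ 2) 0 with hq | hq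
    · have := mul_nonneg hc (neg_nonneg.2 hq)
      have := sq_nonneg (L - a)
      linarith
    · have hlt : a < L := by
        rcases haL.lt_or_eq with h' | h'
        · exact h'
        · subst h'
          nlinarith
      have h1 : c * (L - a) ≤ a := by linarith
      have h2 := mul_le_mul_of_nonneg_right h1 hq.le
      obtain ⟨u, rfl⟩ : ∃ u, L = a + u := ⟨L - a, by ring⟩
      have hu : 0 < u := by linarith
      have h3 : a * (a * (a + u) - (a + u) ^ 2 / 5 - a ^ 2) ≤ u ^ 3 := by
        nlinarith [mul_nonneg ha.le (sq_nonneg (u - 2 / 5 * a)),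
          mul_nonneg hu.le (sq_nonneg (u - 2 / 5 * a)), pow_pos ha 3, pow_pos hu 3,
          mul_pos ha (pow_pos hu 2), mul_pos hu (pow_pos ha 2)]
      refine le_of_mul_le_mul_right ?_ (sub_pos.2 hlt)
      linarith
  have h4 := mul_le_mul_of_nonneg_left h (sub_nonneg.2 haL)
  have h5 : (a - L + (X * (1 - a / L) + c * (4 / 5 * L - a))) * L ≤ 0 * L := by
    have : X * (1 - a / L) * L = X * (L - a) := by field_simp
    linarith
  exact le_of_mul_le_mul_right h5 hL

/-- Bound on the total charge of a server that receives no job. -/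
lemma charge_le_of_no_arrival {a L L' X c : ℝ} (ha : 0 < a) (haL : a ≤ L) (hc : 0 ≤ c)
    (hX : 0 ≤ X) (h : L' + X + c * (L - a) ≤ L) :
    L' - L + (X * (1 - a / L) + c * (4 / 5 * L - a)) ≤ 0 := by
  have hL : 0 < L := ha.trans_le haL
  have h1 : 0 ≤ X * (a / L) := by positivity
  have h2 : 0 ≤ c * L := by positivity
  linarith

lemma sum_load {n m : ℕ} (p : Fin n → ℝ) (σ : Fin n → Fin m) :
    ∑ i, load p σ i = ∑ j, p j :=
  Finset.sum_fiberwise Finset.univ σ p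

lemma le_load {n m : ℕ} {p : Fin n → ℝ} (hp : ∀ j, 0 < p j) (σ : Fin n → Fin m) (j : Fin n) :
    p j ≤ load p σ (σ j) :=
  Finset.single_le_sum (f := p) (fun k _ => (hp k).le) (by simp)

/-- In any load balancing game with `m ≥ 3` identical servers, every NE
assignment is a `5/4`-approximate strong Nash equilibrium. -/
theorem ne_is_five_fourth_approx_sne {n m : ℕ} (hm : 3 ≤ m)
    (p : Fin n → ℝ) (hp : ∀ j, 0 < p j)
    (σ : Fin n → Fin m) (hNE : IsNE p σ)
    (σ' : Fin n → Fin m) (hdev : IsDeviation p σ σ') :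
    ∃ j, σ' j ≠ σ j ∧ load p σ (σ j) ≤ (5 / 4) * load p σ' (σ' j) := by
  classical
  obtain ⟨⟨j₀, hj₀⟩, -⟩ := hdev
  by_contra! H
  -- `a` is the smallest workload
  obtain ⟨i₀, -, hmin⟩ := Finset.exists_min_image Finset.univ (load p σ) ⟨σ j₀, Finset.mem_univ _⟩
  obtain ⟨a, ha_def⟩ : ∃ a, a = load p σ i₀ := ⟨_, rfl⟩
  have haL : ∀ i, a ≤ load p σ i := fun i => ha_def ▸ hmin i (Finset.mem_univ i)
  have hjob : ∀ j, load p σ (σ j) - a ≤ p j := fun j => by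
    have := hNE j i₀
    linarith
  have ha : 0 < a := by
    have h1 := H j₀ hj₀
    have h2 := hjob j₀
    have h3 := le_load hp σ' j₀
    have h4 := hp j₀
    linarith
  have hL : ∀ i, 0 < load p σ i := fun i => ha.trans_le (haL i)
  -- `B`: servers that receive a job (`g` picks one); `K`: servers that keep a job
  let B : Fin m → Prop := fun k => ∃ j, σ' j = k ∧ σ j ≠ k
  let K : Fin m → Prop := fun k => ∃ j, σ j = k ∧ σ' j = k
  obtain ⟨g, hg⟩ : ∃ g : Fin m → Fin n, ∀ k, B k → σ' (g k) = k ∧ σ (g k) ≠ k := by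
    refine ⟨fun k => if h : B k then h.choose else j₀, fun k h => ?_⟩
    simp only [dif_pos h]
    exact h.choose_spec
  -- the charge of a job: nonzero for jobs entering emptied servers and for picked jobs
  let E : Fin n → Prop := fun j => B (σ' j) ∧ ¬ K (σ' j)
  let J : Fin n → Prop := fun j => B (σ' j) ∧ K (σ' j) ∧ g (σ' j) = j
  let v : Fin n → ℝ := fun j => (if E j then p j else 0) * (1 - a / load p σ (σ j)) +
    (if J j then 1 else 0) * (4 / 5 * load p σ (σ j) - a)
  have hcharge : ∀ i, (if B i then a - load p σ i else load p σ' i - load p σ i) +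
      ∑ j with σ j = i, v j ≤ if B i ∧ ¬ K i then a / 5 else 0 := by
    intro i
    have hv : ∑ j with σ j = i, v j =
        (∑ j with σ j = i, if E j then p j else 0) * (1 - a / load p σ i) +
        (∑ j with σ j = i, if J j then (1 : ℝ) else 0) * (4 / 5 * load p σ i - a) := by
      rw [Finset.sum_mul, Finset.sum_mul, ← Finset.sum_add_distrib]
      refine Finset.sum_congr rfl fun j hj => ?_
      simp only [Finset.mem_filter, Finset.mem_univ, true_and] at hj
      simp only [v, hj]
    have hsum : (∑ j with σ j = i, if σ' j = i then p j else 0) +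
        (∑ j with σ j = i, if E j then p j else 0) +
        (∑ j with σ j = i, if J j then (1 : ℝ) else 0) * (load p σ i - a) ≤ load p σ i := by
      conv_rhs => rw [load]
      rw [Finset.sum_mul, ← Finset.sum_add_distrib, ← Finset.sum_add_distrib]
      refine Finset.sum_le_sum fun j hj => ?_
      simp only [Finset.mem_filter, Finset.mem_univ, true_and] at hj
      have hpj := hp j
      have hjj := hjob j
      rw [hj] at hjj
      have hEJ : E j → ¬ J j := fun h h' => h.2 h'.2.1
      have hsE : σ' j = i → ¬ E j := fun h h' => h'.2 ⟨j, by rw [hj, h], rfl⟩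
      have hsJ : σ' j = i → ¬ J j := fun h h' =>
        (hg _ h'.1).2 (by rw [h'.2.2, hj, h])
      by_cases hs : σ' j = i
      · simp [hs, hsE hs, hsJ hs]
      · by_cases hE : E j
        · simp [hs, hE, hEJ hE]
        · by_cases hJ : J j
          · simp [hs, hE, hJ]
            linarith
          · simp [hs, hE, hJ, hpj.le]
    have hX : 0 ≤ ∑ j with σ j = i, if E j then p j else 0 :=
      Finset.sum_nonneg fun j _ => by split_ifs <;> simp [(hp j).le]
    have hc : 0 ≤ ∑ j with σ j = i, if J j then (1 : ℝ) else 0 :=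
      Finset.sum_nonneg fun j _ => by split_ifs <;> simp
    have hs : ∀ j ∈ Finset.univ.filter (fun j => σ j = i), 0 ≤ if σ' j = i then p j else 0 :=
      fun j _ => by split_ifs <;> simp [(hp j).le]
    rw [hv]
    by_cases hB : B i
    · by_cases hK : K i
      · simp only [hB, hK, if_true, not_true, and_false, if_false]
        refine charge_le_of_kept ha (haL i) hc hX ?_
        obtain ⟨j, hj, hj'⟩ := hK
        have h1 := Finset.single_le_sum hs (a := j) (by simp [hj])
        have h2 := hjob j
        rw [hj] at h2
        simp only [hj', if_true] at h1
        linarith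
      · simp only [hB, hK, if_true, not_false_eq_true, and_self]
        refine charge_le_of_emptied ha (haL i) hc hX ?_
        have h1 := Finset.sum_nonneg hs
        linarith
    · simp only [hB, if_false, false_and]
      refine charge_le_of_no_arrival ha (haL i) hc hX ?_
      have h1 : load p σ' i ≤ ∑ j with σ j = i, if σ' j = i then p j else 0 := by
        rw [load, ← Finset.sum_filter, Finset.filter_filter]
        refine (Finset.sum_congr (Finset.filter_congr fun j _ => ?_) fun _ _ => rfl).le
        refine ⟨fun h => ⟨?_, h⟩, fun h => h.2⟩
        by_contra h'
        exact hB ⟨j, h, h'⟩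
      linarith
  have hv0 : ∀ j, 0 ≤ (if E j then p j else 0) * (1 - a / load p σ (σ j)) := fun j => by
    refine mul_nonneg (by split_ifs <;> simp [(hp j).le]) (sub_nonneg.2 ?_)
    exact (div_le_one (hL _)).2 (haL _)
  have htarget : ∀ k, (if B k then load p σ' k - a + (if K k then 0 else a / 5) else 0) ≤
      ∑ j with σ' j = k, v j ∧ (B k →
      (if B k then load p σ' k - a + (if K k then 0 else a / 5) else 0) <
      ∑ j with σ' j = k, v j) := by
    intro k
    by_cases hB : B k
    · suffices h : (if B k then load p σ' k - a + (if K k then 0 else a / 5) else 0) <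
          ∑ j with σ' j = k, v j from ⟨h.le, fun _ => h⟩
      obtain ⟨hg1, hg2⟩ := hg k hB
      have hgm : g k ∈ Finset.univ.filter (fun j => σ' j = k) := by simp [hg1]
      by_cases hK : K k
      · have hval : ∀ j ∈ Finset.univ.filter (fun j => σ' j = k),
            v j = if j = g k then 4 / 5 * load p σ (σ j) - a else 0 := by
          intro j hj
          simp only [Finset.mem_filter, Finset.mem_univ, true_and] at hj
          simp [v, E, J, hj, hB, hK, eq_comm]
        rw [Finset.sum_congr rfl hval, Finset.sum_ite_eq' _ (g k), if_pos hgm]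
        have := H (g k) (by rw [hg1]; exact hg2.symm)
        rw [hg1] at this
        simp only [hB, hK, if_true]
        linarith
      · have hL' : 0 < load p σ' k := by
          have := le_load hp σ' (g k)
          rw [hg1] at this
          exact (hp _).trans_le this
        have hval : ∀ j ∈ Finset.univ.filter (fun j => σ' j = k),
            p j * (1 - 4 / 5 * a / load p σ' k) < v j := by
          intro j hj
          simp only [Finset.mem_filter, Finset.mem_univ, true_and] at hj
          have hne : σ' j ≠ σ j := fun h => hK ⟨j, by rw [← h, hj], hj⟩
          have hlt := H j hne
          rw [hj] at hlt
          have hvj : v j = p j * (1 - a / load p σ (σ j)) := by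
            simp [v, E, J, hj, hB, hK]
          rw [hvj]
          refine mul_lt_mul_of_pos_left (sub_lt_sub_left ?_ _) (hp j)
          rw [div_lt_div_iff₀ (hL _) hL']
          have := mul_lt_mul_of_pos_left hlt ha
          linarith
        have := Finset.sum_lt_sum_of_nonempty ⟨g k, hgm⟩ hval
        rw [← Finset.sum_mul, ← load] at this
        have h2 : load p σ' k * (1 - 4 / 5 * a / load p σ' k) = load p σ' k - 4 / 5 * a := by
          field_simp
        simp only [hB, hK, if_true, if_false]
        linarith
    · refine ⟨?_, fun h => absurd h hB⟩
      rw [if_neg hB]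
      refine Finset.sum_nonneg fun j hj => ?_
      simp only [Finset.mem_filter, Finset.mem_univ, true_and] at hj
      simp [v, E, J, hj, hB]
  have hlt := Finset.sum_lt_sum (s := Finset.univ) (fun k _ => (htarget k).1)
    ⟨σ' j₀, Finset.mem_univ _, (htarget _).2 ⟨j₀, rfl, hj₀.symm⟩⟩
  rw [Finset.sum_fiberwise Finset.univ σ' v] at hlt
  have hle := Finset.sum_le_sum fun i (_ : i ∈ Finset.univ) => hcharge i
  rw [Finset.sum_add_distrib, Finset.sum_fiberwise Finset.univ σ v] at hle
  have hbal : ∑ k, (if B k then load p σ' k - a + (if K k then 0 else a / 5) else 0) +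
      ∑ i, (if B i then a - load p σ i else load p σ' i - load p σ i) =
      (∑ i, load p σ' i - ∑ i, load p σ i) + ∑ i, if B i ∧ ¬ K i then a / 5 else 0 := by
    rw [← Finset.sum_add_distrib, ← Finset.sum_sub_distrib, ← Finset.sum_add_distrib]
    refine Finset.sum_congr rfl fun k _ => ?_
    by_cases hB : B k <;> by_cases hK : K k <;> simp [hB, hK] <;> ring
  rw [sum_load, sum_load] at hbal
  linarith
end

section
/- In a load balancing game with exactly 2 servers, every Nash equilibrium assignment is a strong Nash equilibrium: there exists no coalitional deviation from an NE assignment. -/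
/-- With two servers, the workloads of two distinct servers sum to the total processing time. -/
theorem load_add_load_of_ne {n : ℕ} (p : Fin n → ℝ) (σ : Fin n → Fin 2) {s t : Fin 2}
    (hst : s ≠ t) : load p σ s + load p σ t = ∑ j, p j := by
  have ht : ∀ j, σ j = t ↔ ¬ σ j = s := fun j => by lia
  simp only [load, ht]
  exact Finset.sum_filter_add_sum_filter_not _ _ _

/-- If job `j` joins server `t` and no job leaves it, the workload of `t` grows by at least `p j`. -/
theorem load_add_le_load {n m : ℕ} {p : Fin n → ℝ} (hp : ∀ j, 0 ≤ p j) {σ σ' : Fin n → Fin m}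
    {t : Fin m} {j : Fin n} (hj : σ j ≠ t) (hj' : σ' j = t) (hstay : ∀ k, σ k = t → σ' k = t) :
    load p σ t + p j ≤ load p σ' t := by
  unfold load
  rw [add_comm, ← Finset.sum_insert (by simpa using hj)]
  refine Finset.sum_le_sum_of_subset_of_nonneg (fun k hk => ?_) fun k _ _ => hp k
  grind

/-- In a load balancing game with exactly two servers, every NE assignment is a
strong Nash equilibrium: it admits no coalitional deviation. -/
theorem two_server_ne_is_sne {n : ℕ} (p : Fin n → ℝ) (hp : ∀ j, 0 < p j)
    (σ : Fin n → Fin 2) (hNE : IsNE p σ) :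
    ¬ ∃ σ' : Fin n → Fin 2, IsDeviation p σ σ' := by
  rintro ⟨σ', ⟨j, hj⟩, himp⟩
  by_cases hback : ∃ k, σ k = σ' j ∧ σ' k ≠ σ' j
  · obtain ⟨k, hk, hk'⟩ := hback
    have hkj : σ' k = σ j := by lia
    have h₁ := himp j hj
    have h₂ := himp k (hk ▸ hk')
    rw [hk, hkj] at h₂
    linarith [load_add_load_of_ne p σ hj, load_add_load_of_ne p σ' hj]
  · push Not at hback
    linarith [himp j hj, hNE j (σ' j),
      load_add_le_load (fun k => (hp k).le) hj.symm rfl hback]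
end

section
/- Let m ≥ 3 and let σ be a Nash equilibrium assignment of an m-server load balancing game. If σ′ is a coalitional deviation from σ that involves all m servers and whose deviation graph is minimal, then IR(σ′) ≤ 5/4; that is, some coalition job j satisfies L_σ(σ(j)) ≤ (5/4)·L_{σ′}(σ′(j)). -/
/-- The improvement ratio of a coalitional deviation: the minimum over coalition
jobs of the ratio of pre- and post-deviation costs (as an infimum). -/
noncomputable def IR {n m : ℕ} (p : Fin n → ℝ) (σ σ' : Fin n → Fin m) : ℝ :=
  sInf {r | ∃ j, σ' j ≠ σ j ∧ r = load p σ (σ j) / load p σ' (σ' j)}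

/-- A coalitional deviation is minimal if every coalitional deviation with a
strictly smaller coalition has a strictly smaller improvement ratio. -/
def IsMinimalDeviation {n m : ℕ} (p : Fin n → ℝ) (σ σ' : Fin n → Fin m) : Prop :=
  IsDeviation p σ σ' ∧
    ∀ σ'' : Fin n → Fin m, IsDeviation p σ σ'' →
      {j | σ'' j ≠ σ j} ⊂ {j | σ' j ≠ σ j} → IR p σ σ'' < IR p σ σ'

/-- Server `i` participates in the deviation: its job set changes. -/
def Participates {n m : ℕ} (σ σ' : Fin n → Fin m) (i : Fin m) : Prop :=
  {j | σ j = i} ≠ {j | σ' j = i}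

/-- Local inequality at a server with load `x`, `k` selected out-arcs, on which some job remains.
Here `b` is the size of the jobs moving to servers that are emptied. -/
lemma local_bound_of_remaining {x a b k : ℝ} (hx : 1 ≤ x) (hk : 0 ≤ k) (hb : 0 ≤ b)
    (hab : a + b = x) (ha : (k + 1) * (x - 1) ≤ a) :
    0 ≤ a - 4 / 5 * (k * x) + k - 1 + b / x := by
  have hx0 : 0 < x := by linarith
  obtain ⟨d, rfl⟩ : ∃ d, x = 1 + d := ⟨x - 1, by ring⟩
  have hd : 0 ≤ d := by linarith
  have h1 : b / (1 + d) ≥ b * (1 - d) := by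
    rw [ge_iff_le, le_div_iff₀ hx0]
    nlinarith [mul_nonneg hb (sq_nonneg d)]
  have h2 : b * d ≤ (1 - k * d) * d := mul_le_mul_of_nonneg_right (by linarith) hd
  nlinarith [mul_nonneg hk (sq_nonneg (d - 2 / 5))]

/-- Local inequality at a server with load `x`, `k` selected out-arcs, that all its jobs leave.
Here `b` is the size of the jobs moving to servers that are emptied. -/
lemma local_bound_of_emptied {x a b k : ℝ} (hx : 1 ≤ x) (hk : 0 ≤ k) (hb : 0 ≤ b)
    (hab : a + b = x) (ha : k * (x - 1) ≤ a) :
    0 ≤ a - 4 / 5 * (k * x) + k - 4 / 5 + b / x := by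
  have hx0 : 0 < x := by linarith
  obtain ⟨d, rfl⟩ : ∃ d, x = 1 + d := ⟨x - 1, by ring⟩
  have hd : 0 ≤ d := by linarith
  obtain rfl : b = 1 + d - a := by linarith
  have key : 0 ≤ k * (1 - 3 * d + d ^ 2) + 1 + d := by
    rcases hd.eq_or_lt with rfl | hd
    · nlinarith
    · by_cases h : 0 ≤ 1 - 3 * d + d ^ 2
      · positivity
      · have h1 : k * d ≤ 1 + d := by nlinarith
        have h2 : 0 ≤ (1 + d - k * d) * -(1 - 3 * d + d ^ 2) :=
          mul_nonneg (by linarith) (by linarith)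
        have h3 : 0 ≤ (1 + d) * (1 - d) ^ 2 := by positivity
        refine nonneg_of_mul_nonneg_right (a := d) ?_ hd
        nlinarith
  have h1 : 0 ≤ (a - k * d) * d := mul_nonneg (by linarith) hd
  have h2 : a - 4 / 5 * (k * (1 + d)) + k - 4 / 5 + (1 + d - a) / (1 + d)
      = ((a - k * d) * d + 1 / 5 * (k * (1 - 3 * d + d ^ 2) + 1 + d)) / (1 + d) := by
    field_simp
    ring
  rw [h2]
  positivity

open Finset in
/-- In a game normalized so that loads are at least `1`, no Nash equilibrium admits a coalitional
deviation all of whose improvement ratios exceed `5 / 4`. -/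
lemma exists_load_le_of_one_le {n m : ℕ} {q : Fin n → ℝ} (hq : ∀ j, 0 < q j)
    {σ σ' : Fin n → Fin m} (hL : ∀ i, 1 ≤ load q σ i) (hNE : ∀ j, load q σ (σ j) ≤ 1 + q j)
    (hne : ∃ j, σ' j ≠ σ j) :
    ∃ j, σ' j ≠ σ j ∧ 4 / 5 * load q σ (σ j) ≤ load q σ' (σ' j) := by
  classical
  by_contra! hdev
  set receives : Fin m → Prop := fun v => ∃ j, σ' j = v ∧ σ j ≠ v with hrec
  set retains : Fin m → Prop := fun v => ∃ j, σ' j = v ∧ σ j = v with hret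
  set W : Finset (Fin m) := {v | receives v ∧ retains v} with hW
  set D : Finset (Fin m) := {v | receives v ∧ ¬ retains v} with hD
  have hg : ∀ v, ∃ j, v ∈ W → σ' j = v ∧ σ j ≠ v := by
    intro v
    by_cases hv : v ∈ W
    · obtain ⟨j, hj⟩ := (mem_filter.1 hv).2.1
      exact ⟨j, fun _ => hj⟩
    · exact ⟨hne.choose, fun h => absurd h hv⟩
  choose g hg using hg
  set k : Fin m → Finset (Fin m) := fun u => {v ∈ W | σ (g v) = u} with hk
  set a : Fin m → ℝ := fun u => ∑ j with σ j = u ∧ σ' j ∈ W, q j with ha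
  set b : Fin m → ℝ := fun u => ∑ j with σ j = u ∧ σ' j ∈ D, q j with hb
  have hb0 : ∀ u, 0 ≤ b u := fun u => sum_nonneg fun j _ => (hq j).le
  have hinj : ∀ u, Set.InjOn g (k u : Set (Fin m)) := by
    intro u v hv w hw h
    rw [← (hg v (mem_filter.1 hv).1).1, ← (hg w (mem_filter.1 hw).1).1, h]
  -- the selected jobs leaving `u`, and a remaining job if there is one, have size at least `L u - 1`
  have hsel : ∀ u, ((k u).card : ℝ) * (load q σ u - 1) ≤ a u := by
    intro u
    rw [← card_image_of_injOn (hinj u), ← nsmul_eq_mul]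
    refine (card_nsmul_le_sum _ q _ ?_).trans
      (sum_le_sum_of_subset_of_nonneg ?_ fun j _ _ => (hq j).le)
    · intro j hj
      obtain ⟨v, hv, rfl⟩ := mem_image.1 hj
      have := hNE (g v)
      rw [(mem_filter.1 hv).2] at this
      linarith
    · intro j hj
      obtain ⟨v, hv, rfl⟩ := mem_image.1 hj
      obtain ⟨hvW, hvu⟩ := mem_filter.1 hv
      simpa [hvu, (hg v hvW).1] using hvW
  have hselW : ∀ u ∈ W, ((k u).card + 1 : ℝ) * (load q σ u - 1) ≤ a u := by
    intro u hu
    obtain ⟨i, hi', hi⟩ := (mem_filter.1 hu).2.2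
    have hnot : i ∉ (k u).image g := by
      intro h
      obtain ⟨v, hv, rfl⟩ := mem_image.1 h
      have := hg v (mem_filter.1 hv).1
      exact this.2 (by rw [hi, ← hi', this.1])
    have hcard : ((k u).card + 1 : ℝ) = ((insert i ((k u).image g)).card : ℝ) := by
      rw [card_insert_of_notMem hnot, card_image_of_injOn (hinj u)]
      push_cast
      rfl
    rw [hcard, ← nsmul_eq_mul]
    refine (card_nsmul_le_sum _ q _ ?_).trans
      (sum_le_sum_of_subset_of_nonneg ?_ fun j _ _ => (hq j).le)
    · intro j hj
      rcases mem_insert.1 hj with rfl | hj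
      · have := hNE j
        rw [hi] at this
        linarith
      · obtain ⟨v, hv, rfl⟩ := mem_image.1 hj
        have := hNE (g v)
        rw [(mem_filter.1 hv).2] at this
        linarith
    · intro j hj
      rcases mem_insert.1 hj with rfl | hj
      · simpa [hi, hi'] using hu
      · obtain ⟨v, hv, rfl⟩ := mem_image.1 hj
        obtain ⟨hvW, hvu⟩ := mem_filter.1 hv
        simpa [hvu, (hg v hvW).1] using hvW
  have hsplit : ∀ u, receives u → a u + b u = load q σ u := by
    intro u hu
    have hdisj : Disjoint ({j | σ j = u ∧ σ' j ∈ W} : Finset (Fin n))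
        ({j | σ j = u ∧ σ' j ∈ D} : Finset (Fin n)) := by
      rw [disjoint_filter]
      rintro j - ⟨-, h⟩ ⟨-, h'⟩
      exact (mem_filter.1 h').2.2 (mem_filter.1 h).2.2
    rw [ha, hb, load, ← sum_union hdisj, ← filter_or]
    refine sum_congr (filter_congr fun j _ => ⟨?_, fun h => ?_⟩) fun _ _ => rfl
    · rintro (h | h) <;> exact h.1
    · have hr : receives (σ' j) := by
        by_cases h' : σ' j = u
        · rwa [h']
        · exact ⟨j, rfl, fun h'' => h' (h''.symm.trans h)⟩
      by_cases h' : retains (σ' j)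
      · exact Or.inl ⟨h, mem_filter.2 ⟨mem_univ _, hr, h'⟩⟩
      · exact Or.inr ⟨h, mem_filter.2 ⟨mem_univ _, hr, h'⟩⟩
  have hlocal : ∀ u, 0 ≤ a u - 4 / 5 * ((k u).card * load q σ u) + (k u).card
      - (if u ∈ W then 1 else 0) - 4 / 5 * (if u ∈ D then 1 else 0) + b u / load q σ u := by
    intro u
    have hk0 : (0 : ℝ) ≤ (k u).card := Nat.cast_nonneg _
    by_cases hu : receives u
    · by_cases hu' : retains u
      · have huW : u ∈ W := mem_filter.2 ⟨mem_univ _, hu, hu'⟩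
        have huD : u ∉ D := fun h => (mem_filter.1 h).2.2 hu'
        have := local_bound_of_remaining (hL u) hk0 (hb0 u) (hsplit u hu) (hselW u huW)
        simp only [huW, huD, if_true, if_false]
        linarith
      · have huW : u ∉ W := fun h => hu' (mem_filter.1 h).2.2
        have huD : u ∈ D := mem_filter.2 ⟨mem_univ _, hu, hu'⟩
        have := local_bound_of_emptied (hL u) hk0 (hb0 u) (hsplit u hu) (hsel u)
        simp only [huW, huD, if_true, if_false]
        linarith
    · have huW : u ∉ W := fun h => hu (mem_filter.1 h).2.1
      have huD : u ∉ D := fun h => hu (mem_filter.1 h).2.1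
      have h1 := hsel u
      have h2 : 0 ≤ b u / load q σ u := div_nonneg (hb0 u) (zero_le_one.trans (hL u))
      have h3 := mul_nonneg hk0 (zero_le_one.trans (hL u))
      simp only [huW, huD, if_false]
      linarith
  have hsum := sum_nonneg fun u (_ : u ∈ univ) => hlocal u
  rw [sum_add_distrib, sum_sub_distrib, sum_sub_distrib, sum_add_distrib, sum_sub_distrib, ← mul_sum,
    ← mul_sum] at hsum
  have hfib : ∀ (s : Finset (Fin m)) (F : Fin n → ℝ),
      ∑ u, ∑ j with σ j = u ∧ σ' j ∈ s, F j = ∑ v ∈ s, ∑ j with σ' j = v, F j := by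
    intro s F
    have h1 : ∀ u, ∑ j with σ j = u ∧ σ' j ∈ s, F j
        = ∑ j ∈ univ.filter (fun j => σ' j ∈ s) with σ j = u, F j := by
      intro u
      rw [filter_filter]
      exact sum_congr (filter_congr fun j _ => and_comm) fun _ _ => rfl
    have h2 : ∀ v ∈ s, ∑ j with σ' j = v, F j
        = ∑ j ∈ univ.filter (fun j => σ' j ∈ s) with σ' j = v, F j := by
      intro v hv
      rw [filter_filter]
      exact sum_congr (filter_congr fun j _ => ⟨fun h => ⟨h ▸ hv, h⟩, fun h => h.2⟩) fun _ _ => rfl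
    rw [sum_congr rfl fun u _ => h1 u, sum_congr rfl h2, sum_fiberwise,
      sum_fiberwise_of_maps_to fun j hj => (mem_filter.1 hj).2]
  have hkcard : ∑ u, ((k u).card : ℝ) = W.card := by
    rw [← Nat.cast_sum, ← card_eq_sum_card_fiberwise fun v _ => mem_coe.2 (mem_univ (σ (g v)))]
  have hkload : ∑ u, ((k u).card : ℝ) * load q σ u = ∑ v ∈ W, load q σ (σ (g v)) := by
    rw [← sum_fiberwise W (fun v => σ (g v))]
    refine sum_congr rfl fun u _ => ?_
    rw [← nsmul_eq_mul, ← sum_const]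
    exact sum_congr rfl fun v hv => by rw [(mem_filter.1 hv).2]
  have hasum : ∑ u, a u = ∑ v ∈ W, load q σ' v := hfib W q
  have hbsum : ∑ u, b u / load q σ u = ∑ v ∈ D, ∑ j with σ' j = v, q j / load q σ (σ j) := by
    rw [← hfib D]
    refine sum_congr rfl fun u _ => ?_
    rw [hb, sum_div]
    exact sum_congr rfl fun j hj => by rw [(mem_filter.1 hj).2.1]
  have hWlt : ∀ v ∈ W, load q σ' v < 4 / 5 * load q σ (σ (g v)) := by
    intro v hv
    have h := hdev (g v) (by rw [(hg v hv).1]; exact (hg v hv).2.symm)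
    rwa [(hg v hv).1] at h
  have hDlt : ∀ v ∈ D, ∑ j with σ' j = v, q j / load q σ (σ j) < 4 / 5 := by
    intro v hv
    obtain ⟨⟨i, hi, -⟩, hv'⟩ := (mem_filter.1 hv).2
    have hmem : i ∈ ({j | σ' j = v} : Finset (Fin n)) := by simpa using hi
    have hpos : 0 < load q σ' v := sum_pos (fun j _ => hq j) ⟨i, hmem⟩
    have h45 : ∑ j with σ' j = v, 4 / 5 * (q j / load q σ' v) = 4 / 5 := by
      rw [← mul_sum, ← sum_div, ← load, div_self hpos.ne', mul_one]
    rw [← h45]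
    refine sum_lt_sum_of_nonempty ⟨i, hmem⟩ fun j hj => ?_
    have hj : σ' j = v := (mem_filter.1 hj).2
    have h := hdev j fun h => hv' ⟨j, hj, h.symm.trans hj⟩
    rw [hj] at h
    rw [div_lt_iff₀ (zero_lt_one.trans_le (hL _))]
    have : 4 / 5 * (q j / load q σ' v) * load q σ (σ j)
        = q j * (4 / 5 * load q σ (σ j)) / load q σ' v := by ring
    rw [this, lt_div_iff₀ hpos]
    exact mul_lt_mul_of_pos_left h (hq j)
  rw [hkcard, hkload, hasum, hbsum, sum_boole, sum_boole, filter_univ_mem, filter_univ_mem] at hsum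
  have hDle : ∑ v ∈ D, ∑ j with σ' j = v, q j / load q σ (σ j) ≤ 4 / 5 * D.card := by
    have := sum_le_card_nsmul D _ _ fun v hv => (hDlt v hv).le
    rw [nsmul_eq_mul] at this
    linarith
  have hWle := sum_le_sum fun v hv => (hWlt v hv).le
  rw [← mul_sum] at hWle
  obtain ⟨j, hj⟩ := hne
  have hr : receives (σ' j) := ⟨j, rfl, hj.symm⟩
  by_cases hr' : retains (σ' j)
  · have := sum_lt_sum_of_nonempty ⟨σ' j, mem_filter.2 ⟨mem_univ _, hr, hr'⟩⟩ hWlt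
    rw [← mul_sum] at this
    linarith
  · have := sum_lt_sum_of_nonempty ⟨σ' j, mem_filter.2 ⟨mem_univ _, hr, hr'⟩⟩ hDlt
    rw [sum_const, nsmul_eq_mul] at this
    linarith

/-- No Nash equilibrium admits a coalitional deviation all of whose improvement ratios exceed
`5 / 4`. -/
lemma IsNE.exists_load_le {n m : ℕ} {p : Fin n → ℝ} (hp : ∀ j, 0 < p j)
    {σ σ' : Fin n → Fin m} (hNE : IsNE p σ) (hne : ∃ j, σ' j ≠ σ j) :
    ∃ j, σ' j ≠ σ j ∧ load p σ (σ j) ≤ 5 / 4 * load p σ' (σ' j) := by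
  obtain ⟨j₀, hj₀⟩ := hne
  have : Nonempty (Fin m) := ⟨σ j₀⟩
  obtain ⟨i₀, hi₀⟩ := Finite.exists_min (load p σ)
  have hnonneg : ∀ τ : Fin n → Fin m, ∀ i, 0 ≤ load p τ i :=
    fun τ i => Finset.sum_nonneg fun j _ => (hp j).le
  rcases (hnonneg σ i₀).eq_or_lt with h0 | h0
  · refine ⟨j₀, hj₀, ?_⟩
    have h1 := hNE j₀ i₀
    have h2 : p j₀ ≤ load p σ' (σ' j₀) :=
      Finset.single_le_sum (f := p) (fun j _ => (hp j).le)
        (Finset.mem_filter.2 ⟨Finset.mem_univ _, rfl⟩)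
    linarith [hp j₀]
  · have hscale : ∀ (τ : Fin n → Fin m) i,
        load (fun j => p j / load p σ i₀) τ i = load p τ i / load p σ i₀ :=
      fun τ i => (Finset.sum_div _ _ _).symm
    obtain ⟨j, hj, h⟩ := exists_load_le_of_one_le (q := fun j => p j / load p σ i₀) (σ := σ)
      (σ' := σ') (fun j => div_pos (hp j) h0)
      (fun i => by rw [hscale, one_le_div h0]; exact hi₀ i)
      (fun j => by
        rw [hscale, div_le_iff₀ h0, add_mul, one_mul, div_mul_cancel₀ _ h0.ne']
        exact hNE j i₀)
      ⟨j₀, hj₀⟩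
    refine ⟨j, hj, ?_⟩
    rw [hscale, hscale, ← mul_div_assoc, div_le_div_iff_of_pos_right h0] at h
    linarith

/-- If `σ'` is a minimal coalitional deviation from an NE assignment `σ` of an
`m`-server game (`m ≥ 3`) involving all `m` servers, then `IR(σ') ≤ 5/4`; that
is, some coalition job `j` has `L_σ(σ j) ≤ (5/4) · L_{σ'}(σ' j)`. -/
theorem minimal_deviation_IR_le_five_fourth {n m : ℕ} (hm : 3 ≤ m)
    (p : Fin n → ℝ) (hp : ∀ j, 0 < p j)
    (σ : Fin n → Fin m) (hNE : IsNE p σ)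
    (σ' : Fin n → Fin m) (hmin : IsMinimalDeviation p σ σ')
    (hall : ∀ i, Participates σ σ' i) :
    IR p σ σ' ≤ 5 / 4 ∧
      ∃ j, σ' j ≠ σ j ∧ load p σ (σ j) ≤ (5 / 4) * load p σ' (σ' j) := by
  obtain ⟨j, hj, h⟩ := hNE.exists_load_le hp hmin.1.1
  refine ⟨?_, j, hj, h⟩
  have hnonneg : ∀ (τ : Fin n → Fin m) i, 0 ≤ load p τ i :=
    fun τ i => Finset.sum_nonneg fun j _ => (hp j).le
  have hbdd : BddBelow {r | ∃ j, σ' j ≠ σ j ∧ r = load p σ (σ j) / load p σ' (σ' j)} := by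
    refine ⟨0, ?_⟩
    rintro _ ⟨i, -, rfl⟩
    exact div_nonneg (hnonneg _ _) (hnonneg _ _)
  exact (csInf_le hbdd ⟨j, hj, rfl⟩).trans (div_le_of_le_mul₀ (hnonneg _ _) (by norm_num) h)
end

section
/- Let σ′ be a minimal coalitional deviation from an NE assignment σ of a load balancing game. Then every participating server has in-degree at least 1 in the deviation graph; that is, for every participating server i there is a coalition job j with σ′(j) = i. -/
theorem load_nonneg {n m : ℕ} {p : Fin n → ℝ} (hp : ∀ j, 0 < p j)
    (σ : Fin n → Fin m) (i : Fin m) : 0 ≤ load p σ i :=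
  Finset.sum_nonneg fun j _ => (hp j).le

/-- The workload of a server that receives a job is positive. -/
theorem load_pos {n m : ℕ} {p : Fin n → ℝ} (hp : ∀ j, 0 < p j)
    (σ : Fin n → Fin m) (j : Fin n) : 0 < load p σ (σ j) :=
  Finset.sum_pos (fun k _ => hp k) ⟨j, by simp⟩

/-- Workload is monotone in the set of assigned jobs. -/
theorem load_le_load {n m : ℕ} {p : Fin n → ℝ} (hp : ∀ j, 0 < p j)
    {σ τ : Fin n → Fin m} {i : Fin m} (h : ∀ j, σ j = i → τ j = i) :
    load p σ i ≤ load p τ i :=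
  Finset.sum_le_sum_of_subset_of_nonneg
    (fun j hj => by simpa using h j (by simpa using hj)) fun j _ _ => (hp j).le

/-- In a deviation from an NE, every server that some coalition job joins is also left by
some coalition job. -/
theorem IsNE.exists_leaving {n m : ℕ} {p : Fin n → ℝ} (hp : ∀ j, 0 < p j)
    {σ σ' : Fin n → Fin m} (hNE : IsNE p σ) (hdev : IsDeviation p σ σ')
    {j : Fin n} (hj : σ' j ≠ σ j) :
    ∃ k, σ k = σ' j ∧ σ' k ≠ σ k := by
  by_contra! hstay
  have hsub : insert j (Finset.univ.filter fun k => σ k = σ' j) ⊆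
      Finset.univ.filter fun k => σ' k = σ' j := by
    intro k hk
    rcases Finset.mem_insert.1 hk with rfl | hk
    · simp
    · have hk' : σ k = σ' j := by simpa using hk
      simpa using (hstay k hk').trans hk'
  have hle : p j + load p σ (σ' j) ≤ load p σ' (σ' j) := by
    have := Finset.sum_le_sum_of_subset_of_nonneg (f := p) hsub fun k _ _ => (hp k).le
    rwa [Finset.sum_insert (by simpa using hj.symm)] at this
  linarith [hdev.2 j hj, hNE j (σ' j)]

/-- If the coalition of `τ` is part of that of `σ'` and its jobs do at least as well under `τ`
as under `σ'`, then the improvement ratio of `τ` is at least that of `σ'`. -/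
theorem IR_le_IR {n m : ℕ} {p : Fin n → ℝ} (hp : ∀ j, 0 < p j)
    {σ σ' τ : Fin n → Fin m} (hne : ∃ j, τ j ≠ σ j)
    (hsub : ∀ j, τ j ≠ σ j → σ' j ≠ σ j)
    (hle : ∀ j, τ j ≠ σ j → load p τ (τ j) ≤ load p σ' (σ' j)) :
    IR p σ σ' ≤ IR p σ τ := by
  obtain ⟨k, hk⟩ := hne
  refine le_csInf ⟨_, k, hk, rfl⟩ ?_
  rintro _ ⟨j, hj, rfl⟩
  have hbdd : BddBelow {r | ∃ j, σ' j ≠ σ j ∧ r = load p σ (σ j) / load p σ' (σ' j)} := by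
    refine ⟨0, ?_⟩
    rintro _ ⟨l, -, rfl⟩
    exact div_nonneg (load_nonneg hp _ _) (load_nonneg hp _ _)
  exact (csInf_le hbdd ⟨j, hsub j hj, rfl⟩).trans
    (div_le_div_of_nonneg_left (load_nonneg hp _ _) (load_pos hp τ j) (hle j hj))

/-- In a minimal coalitional deviation from an NE, every participating server
has in-degree at least 1 in the deviation graph: some coalition job moves to it. -/
theorem minimal_deviation_indeg_ge_one {n m : ℕ}
    (p : Fin n → ℝ) (hp : ∀ j, 0 < p j)
    (σ : Fin n → Fin m) (hNE : IsNE p σ)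
    (σ' : Fin n → Fin m) (hmin : IsMinimalDeviation p σ σ')
    (i : Fin m) (hi : Participates σ σ' i) :
    ∃ j, σ' j ≠ σ j ∧ σ' j = i := by
  by_contra! hin
  obtain ⟨hdev, hmin⟩ := hmin
  obtain ⟨j, hji, hj⟩ : ∃ j, σ j = i ∧ σ' j ≠ σ j := by
    by_contra! hout
    refine hi (Set.ext fun j => ⟨fun h => (hout j h).trans h, fun h => ?_⟩)
    by_contra hne
    exact hin j (fun he => hne (he.symm.trans h)) h
  -- Keep the jobs of server `i` in place and let the rest of the coalition deviate.
  let τ : Fin n → Fin m := fun k => if σ k = i then i else σ' k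
  have hτ : ∀ k, τ k ≠ σ k ↔ σ k ≠ i ∧ σ' k ≠ σ k := by
    intro k
    by_cases h : σ k = i <;> simp [τ, h]
  have hle : ∀ k, τ k ≠ σ k → load p τ (τ k) ≤ load p σ' (σ' k) := by
    intro k hk
    obtain ⟨hki, hk'⟩ := (hτ k).1 hk
    have hτk : τ k = σ' k := if_neg hki
    rw [hτk]
    refine load_le_load hp fun l hl => ?_
    by_cases h : σ l = i
    · exact absurd (hl.symm.trans (if_pos h)) (hin k hk')
    · exact (if_neg h).symm.trans hl
  have hne : ∃ k, τ k ≠ σ k := by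
    obtain ⟨k, hk, hk'⟩ := hNE.exists_leaving hp hdev hj
    exact ⟨k, (hτ k).2 ⟨fun h => hin j hj (hk.symm.trans h), hk'⟩⟩
  have hτdev : IsDeviation p σ τ :=
    ⟨hne, fun k hk => (hle k hk).trans_lt (hdev.2 k ((hτ k).1 hk).2)⟩
  refine (hmin τ hτdev ⟨fun k hk => ((hτ k).1 hk).2, fun h => ?_⟩).not_ge
    (IR_le_IR hp hne (fun k hk => ((hτ k).1 hk).2) hle)
  exact ((hτ j).1 (h hj)).1 hji
end

section
/- Let σ be an NE assignment of a load balancing game. For every server i that holds a_i ≥ 1 jobs under σ, one has (a_i − 1)·L_σ(i) ≤ a_i · min_k L_σ(k). In particular, under the normalization min_k L_σ(k) = 1, every server with a_i ≥ 2 jobs satisfies L_σ(i) ≤ a_i/(a_i − 1). -/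
/-- The number of jobs assigned to server `i` under `σ`. -/
def jobCount {n m : ℕ} (σ : Fin n → Fin m) (i : Fin m) : ℕ :=
  (Finset.univ.filter (fun j => σ j = i)).card

/-- Under a Nash equilibrium, averaging the stability condition over the jobs of server `i`
bounds its workload in terms of that of any server `k`. -/
theorem IsNE.jobCount_sub_one_mul_load_le {n m : ℕ} {p : Fin n → ℝ} {σ : Fin n → Fin m}
    (hNE : IsNE p σ) (i k : Fin m) :
    ((jobCount σ i : ℝ) - 1) * load p σ i ≤ (jobCount σ i : ℝ) * load p σ k := by
  have h : ∑ _j ∈ Finset.univ.filter (fun j => σ j = i), load p σ i ≤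
      ∑ j ∈ Finset.univ.filter (fun j => σ j = i), (load p σ k + p j) := by
    refine Finset.sum_le_sum fun j hj => ?_
    have hij := hNE j k
    rwa [(Finset.mem_filter.mp hj).2] at hij
  rw [Finset.sum_add_distrib, Finset.sum_const, Finset.sum_const, nsmul_eq_mul,
    nsmul_eq_mul] at h
  change (jobCount σ i : ℝ) * load p σ i ≤ (jobCount σ i : ℝ) * load p σ k + load p σ i at h
  linarith

/-- For an NE assignment, every server `i` holding `a_i ≥ 1` jobs satisfies
`(a_i − 1)·L_σ(i) ≤ a_i · min_k L_σ(k)`; in particular, under the normalization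
`min_k L_σ(k) = 1`, every server with `a_i ≥ 2` jobs has
`L_σ(i) ≤ a_i/(a_i − 1)`. -/
theorem ne_load_upper_bound {n m : ℕ}
    (p : Fin n → ℝ) (hp : ∀ j, 0 < p j)
    (σ : Fin n → Fin m) (hNE : IsNE p σ)
    (i : Fin m) (hi : 1 ≤ jobCount σ i) :
    ((jobCount σ i : ℝ) - 1) * load p σ i ≤
        (jobCount σ i : ℝ) * Finset.univ.inf' ⟨i, Finset.mem_univ i⟩ (load p σ) ∧
      (Finset.univ.inf' ⟨i, Finset.mem_univ i⟩ (load p σ) = 1 → 2 ≤ jobCount σ i →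
        load p σ i ≤ (jobCount σ i : ℝ) / ((jobCount σ i : ℝ) - 1)) := by
  have h : ((jobCount σ i : ℝ) - 1) * load p σ i ≤
      (jobCount σ i : ℝ) * Finset.univ.inf' ⟨i, Finset.mem_univ i⟩ (load p σ) := by
    obtain ⟨k, -, hk⟩ := Finset.exists_mem_eq_inf' ⟨i, Finset.mem_univ i⟩ (load p σ)
    rw [hk]
    exact hNE.jobCount_sub_one_mul_load_le i k
  refine ⟨h, fun hmin ha => ?_⟩
  have ha' : (2 : ℝ) ≤ jobCount σ i := by exact_mod_cast ha
  rw [hmin, mul_one] at h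
  rw [le_div_iff₀ (by linarith), mul_comm]
  exact h
end

section
/- Let σ′ be a minimal coalitional deviation from an NE assignment σ of a load balancing game, and suppose some coalition job migrates from server u to server v (i.e., σ(j₀) = u and σ′(j₀) = v for some coalition job j₀). If every job assigned to u under σ belongs to the coalition, then some job assigned to v under σ does not belong to the coalition. -/
/-- Renaming the servers by a permutation renames the workloads. -/
theorem load_perm_comp {n m : ℕ} (p : Fin n → ℝ) (σ : Fin n → Fin m) (e : Equiv.Perm (Fin m))
    (i : Fin m) : load p (fun j => e (σ j)) (e i) = load p σ i := by
  simp [load]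

/-- The improvement ratio can only grow when the coalition shrinks to a nonempty one whose members
face the same costs. -/
theorem IR_le_IR_of_coalition_subset {n m : ℕ} (p : Fin n → ℝ) {σ σ' σ'' : Fin n → Fin m}
    (hne : ∃ j, σ'' j ≠ σ j) (hsub : ∀ j, σ'' j ≠ σ j → σ' j ≠ σ j)
    (hcost : ∀ j, load p σ'' (σ'' j) = load p σ' (σ' j)) : IR p σ σ' ≤ IR p σ σ'' := by
  refine csInf_le_csInf (Set.Finite.bddBelow ?_) ?_ ?_
  · refine (Set.finite_range fun j => load p σ (σ j) / load p σ' (σ' j)).subset ?_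
    rintro r ⟨j, -, rfl⟩
    exact ⟨j, rfl⟩
  · obtain ⟨j, hj⟩ := hne
    exact ⟨_, j, hj, rfl⟩
  · rintro r ⟨j, hj, rfl⟩
    exact ⟨j, hsub j hj, by rw [hcost]⟩

/-- In a minimal coalitional deviation from an NE, if a coalition job migrates
from server `u` to server `v` and every job on `u` belongs to the coalition,
then some job on `v` does not belong to the coalition. -/
theorem migration_target_keeps_a_job {n m : ℕ}
    (p : Fin n → ℝ) (hp : ∀ j, 0 < p j)
    (σ : Fin n → Fin m) (hNE : IsNE p σ)
    (σ' : Fin n → Fin m) (hmin : IsMinimalDeviation p σ σ')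
    (u v : Fin m) (j₀ : Fin n) (hj₀ : σ' j₀ ≠ σ j₀)
    (hu : σ j₀ = u) (hv : σ' j₀ = v)
    (hallu : ∀ j, σ j = u → σ' j ≠ σ j) :
    ∃ j, σ j = v ∧ σ' j = σ j := by
  by_contra! hallv
  obtain ⟨⟨-, himp⟩, hmin⟩ := hmin
  let σ'' : Fin n → Fin m := fun j => Equiv.swap u v (σ' j)
  have hcost (j : Fin n) : load p σ'' (σ'' j) = load p σ' (σ' j) :=
    load_perm_comp p σ' (Equiv.swap u v) (σ' j)
  have hsub (j : Fin n) (hj : σ'' j ≠ σ j) : σ' j ≠ σ j := by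
    intro h
    apply hj
    change Equiv.swap u v (σ' j) = σ j
    rw [h]
    exact Equiv.swap_apply_of_ne_of_ne (fun hju => hallu j hju h) (fun hjv => hallv j hjv h)
  have hstay : σ'' j₀ = σ j₀ := by
    change Equiv.swap u v (σ' j₀) = σ j₀
    rw [hv, hu, Equiv.swap_apply_right]
  by_cases hne : ∃ j, σ'' j ≠ σ j
  · have hdev : IsDeviation p σ σ'' :=
      ⟨hne, fun j hj => by rw [hcost]; exact himp j (hsub j hj)⟩
    have hss : {j | σ'' j ≠ σ j} ⊂ {j | σ' j ≠ σ j} :=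
      ⟨hsub, fun h => h hj₀ hstay⟩
    exact (hmin σ'' hdev hss).not_ge (IR_le_IR_of_coalition_subset p hne hsub hcost)
  · push Not at hne
    have hlt := himp j₀ hj₀
    rw [← hcost, funext hne] at hlt
    exact hlt.false
end

section
/- Let σ′ be a minimal coalitional deviation from an NE assignment σ of a load balancing game, and let u ≠ v be two participating servers such that every job assigned to u under σ and every job assigned to v under σ belongs to the coalition. Define σ″ by σ″(k) = v if σ′(k) = u, σ″(k) = u if σ′(k) = v, and σ″(k) = σ′(k) otherwise. Then σ″ is a coalitional deviation from σ with the same coalition as σ′, IR(σ″) = IR(σ′), and σ″ is also minimal. -/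
/-- The improvement ratio does not decrease when the coalition shrinks to a nonempty subset and
the remaining jobs keep their costs. -/
lemma IR_le_IR_of_subset {n m : ℕ} (p : Fin n → ℝ) (σ σ' τ : Fin n → Fin m)
    (hne : ∃ j, τ j ≠ σ j) (hsub : ∀ j, τ j ≠ σ j → σ' j ≠ σ j)
    (hcost : ∀ j, load p τ (τ j) = load p σ' (σ' j)) : IR p σ σ' ≤ IR p σ τ := by
  refine csInf_le_csInf (Set.Finite.bddBelow ?_) ?_ ?_
  · refine (Set.finite_range fun j => load p σ (σ j) / load p σ' (σ' j)).subset ?_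
    rintro r ⟨j, -, rfl⟩
    exact ⟨j, rfl⟩
  · obtain ⟨j, hj⟩ := hne
    exact ⟨_, j, hj, rfl⟩
  · rintro r ⟨j, hj, rfl⟩
    exact ⟨j, hsub j hj, by rw [hcost]⟩

/-- Relabelling the servers injectively keeps the cost of every job. -/
lemma load_comp_of_injective {n m : ℕ} (p : Fin n → ℝ) (σ τ : Fin n → Fin m)
    (f : Fin m → Fin m) (hf : Function.Injective f) (hτ : ∀ k, τ k = f (σ k)) (j : Fin n) :
    load p τ (τ j) = load p σ (σ j) := by
  simp only [load, hτ, hf.eq_iff]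

/-- Swapping the destinations `u` and `v` in a minimal coalitional deviation,
where `u ≠ v` are participating servers all of whose jobs under `σ` belong to
the coalition, yields a coalitional deviation with the same coalition and the
same improvement ratio, which is again minimal. -/
theorem swap_targets_preserves_minimality {n m : ℕ}
    (p : Fin n → ℝ) (hp : ∀ j, 0 < p j)
    (σ : Fin n → Fin m) (hNE : IsNE p σ)
    (σ' : Fin n → Fin m) (hmin : IsMinimalDeviation p σ σ')
    (u v : Fin m) (huv : u ≠ v)
    (hu : Participates σ σ' u) (hv : Participates σ σ' v)
    (hallu : ∀ j, σ j = u → σ' j ≠ σ j) (hallv : ∀ j, σ j = v → σ' j ≠ σ j)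
    (σ'' : Fin n → Fin m)
    (hσ'' : ∀ k, σ'' k = if σ' k = u then v else if σ' k = v then u else σ' k) :
    IsDeviation p σ σ'' ∧
      {j | σ'' j ≠ σ j} = {j | σ' j ≠ σ j} ∧
      IR p σ σ'' = IR p σ σ' ∧
      IsMinimalDeviation p σ σ'' := by
  have hswap : ∀ k, σ'' k = Equiv.swap u v (σ' k) := fun k => by
    rw [hσ'' k, Equiv.swap_apply_def]
  have hcost := load_comp_of_injective p σ' σ'' _ (Equiv.swap u v).injective hswap
  have hsub : ∀ j, σ'' j ≠ σ j → σ' j ≠ σ j := by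
    intro j hj h
    have h1 : σ' j ≠ u := fun h' => hallu j (h ▸ h') h
    have h2 : σ' j ≠ v := fun h' => hallv j (h ▸ h') h
    exact hj (by rw [hσ'' j, if_neg h1, if_neg h2, h])
  have hne : ∃ j, σ'' j ≠ σ j := by
    by_contra! h
    obtain ⟨j, hj⟩ := hmin.1.1
    have hlt := hmin.1.2 j hj
    rw [← hcost j, funext h] at hlt
    exact lt_irrefl _ hlt
  have hdev : IsDeviation p σ σ'' :=
    ⟨hne, fun j hj => (hcost j).trans_lt (hmin.1.2 j (hsub j hj))⟩
  have hcoal : {j | σ'' j ≠ σ j} = {j | σ' j ≠ σ j} := by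
    by_contra h
    exact absurd (hmin.2 σ'' hdev (Set.ssubset_iff_subset_ne.2 ⟨hsub, h⟩))
      (IR_le_IR_of_subset p σ σ' σ'' hne hsub hcost).not_gt
  have hIR : IR p σ σ'' = IR p σ σ' :=
    le_antisymm
      (IR_le_IR_of_subset p σ σ'' σ' hmin.1.1 (fun _ hj => hcoal.symm.subset hj)
        fun j => (hcost j).symm)
      (IR_le_IR_of_subset p σ σ' σ'' hne hsub hcost)
  refine ⟨hdev, hcoal, hIR, hdev, fun τ hτ hss => ?_⟩
  rw [hIR]
  exact hmin.2 τ hτ (hcoal ▸ hss)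
end

section
/- Let σ′ be a minimal coalitional deviation from an NE assignment σ of an m-server load balancing game in which all m servers participate, and let Ã be an arc subset satisfying Assumption 1. Then b_i = 1 for every server i ∈ W₁, and moreover {v : (u,v) ∈ A for some u ∈ W₀ ∪ W₁} = W̃₁. -/
open scoped Classical

/-- `(u,v)` is an arc of the deviation graph. -/
def Arc {n m : ℕ} (σ σ' : Fin n → Fin m) (u v : Fin m) : Prop :=
  ∃ j, σ' j ≠ σ j ∧ σ j = u ∧ σ' j = v

/-- An arc subset `At ⊆ A` is tilde-valid if every server has exactly one
incoming arc in `At`. -/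
def TildeValid {n m : ℕ} (σ σ' : Fin n → Fin m) (At : Finset (Fin m × Fin m)) : Prop :=
  (∀ e ∈ At, Arc σ σ' e.1 e.2) ∧
    ∀ i : Fin m, (At.filter (fun e => e.2 = i)).card = 1

/-- The out-degree `b_i` of server `i` in the arc subset `At`. -/
def outDeg {m : ℕ} (At : Finset (Fin m × Fin m)) (i : Fin m) : ℕ :=
  (At.filter (fun e => e.1 = i)).card

/-- `W₀`: the servers with out-degree `0` in `At`. -/
def W0 {m : ℕ} (At : Finset (Fin m × Fin m)) : Finset (Fin m) :=
  Finset.univ.filter (fun i => outDeg At i = 0)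

/-- Server `i` is associated with `W₀`: it is linked to an `A`-out-neighbour of
`W₀` through a sequence of arcs in `At` and `A` in alternation. -/
def AssociatedW0 {n m : ℕ} (σ σ' : Fin n → Fin m)
    (At : Finset (Fin m × Fin m)) (i : Fin m) : Prop :=
  ∃ (k : ℕ) (is js : ℕ → Fin m),
    i = is k ∧
    (∃ u ∈ W0 At, Arc σ σ' u (js 0)) ∧
    (∀ t ≤ k, (is t, js t) ∈ At) ∧
    (∀ t < k, Arc σ σ' (is t) (js (t + 1)))

/-- `W₁`: the servers associated with `W₀`. -/
noncomputable def W1 {n m : ℕ} (σ σ' : Fin n → Fin m)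
    (At : Finset (Fin m × Fin m)) : Finset (Fin m) :=
  Finset.univ.filter (fun i => AssociatedW0 σ σ' At i)

/-- `W̃₁`: the `At`-out-neighbours of `W₁`. -/
noncomputable def W1t {n m : ℕ} (σ σ' : Fin n → Fin m)
    (At : Finset (Fin m × Fin m)) : Finset (Fin m) :=
  Finset.univ.filter (fun v => ∃ u ∈ W1 σ σ' At, (u, v) ∈ At)

/-- Assumption 1: `At` is tilde-valid and minimizes `|W₀|` among all tilde-valid
arc subsets. -/
def Assumption1 {n m : ℕ} (σ σ' : Fin n → Fin m)
    (At : Finset (Fin m × Fin m)) : Prop :=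
  TildeValid σ σ' At ∧
    ∀ At' : Finset (Fin m × Fin m), TildeValid σ σ' At' →
      (W0 At).card ≤ (W0 At').card

/-- No augmenting alternating path: let the parent map `f` of a relation `R` have an image of
maximum size. If an alternating path starts at a vertex outside that image, then the last child
on the path is the only child of its parent. -/
theorem eq_of_parent_eq_of_alternating_path {α : Type*} [Fintype α] [DecidableEq α]
    {R : α → α → Prop} (k : ℕ) (f : α → α) (u : α) (js : ℕ → α)
    (hf : ∀ v, R (f v) v)
    (hmax : ∀ g : α → α, (∀ v, R (g v) v) →
      (Finset.univ.image g).card ≤ (Finset.univ.image f).card)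
    (hu : ∀ v, f v ≠ u) (hstart : R u (js 0))
    (hstep : ∀ t < k, R (f (js t)) (js (t + 1))) (w : α) (hw : f w = f (js k)) :
    w = js k := by
  induction k using Nat.strong_induction_on generalizing f u js with
  | _ k ih =>
  by_cases hrep : ∃ t, t + 1 ≤ k ∧ js (t + 1) = js 0
  · obtain ⟨t, htk, ht⟩ := hrep
    have hk : k - (t + 1) + (t + 1) = k := by omega
    have := ih (k - (t + 1)) (by omega) f u (fun s => js (s + (t + 1))) hf hmax hu
      (by simpa [ht] using hstart)
      (fun s hs => by
        have := hstep (s + (t + 1)) (by omega)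
        rwa [show s + (t + 1) + 1 = s + 1 + (t + 1) by omega] at this)
      (by simpa only [hk] using hw)
    simpa only [hk] using this
  push Not at hrep
  set g := Function.update f (js 0) u with hg
  have hg0 : g (js 0) = u := by simp [hg]
  have hgne : ∀ v, v ≠ js 0 → g v = f v := fun v hv => by simp [hg, hv]
  have hRg : ∀ v, R (g v) v := fun v => by
    by_cases hv : v = js 0
    · rw [hv, hg0]; exact hstart
    · rw [hgne v hv]; exact hf v
  have hunot : u ∉ Finset.univ.image f := by simpa using hu
  have huniq : ∀ x, f x = f (js 0) → x = js 0 := by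
    intro x hx
    by_contra hne
    have hsub : insert u (Finset.univ.image f) ⊆ Finset.univ.image g := by
      intro y hy
      simp only [Finset.mem_insert, Finset.mem_image, Finset.mem_univ, true_and] at hy ⊢
      rcases hy with rfl | ⟨v, rfl⟩
      · exact ⟨_, hg0⟩
      · by_cases hv : v = js 0
        · exact ⟨x, by rw [hgne x hne, hx, hv]⟩
        · exact ⟨v, hgne v hv⟩
    have h1 := Finset.card_le_card hsub
    rw [Finset.card_insert_of_notMem hunot] at h1
    have h2 := hmax g hRg
    omega
  rcases k with _ | k
  · exact huniq w hw
  have hcard : (Finset.univ.image f).card ≤ (Finset.univ.image g).card := by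
    have hsub : insert u ((Finset.univ.image f).erase (f (js 0))) ⊆ Finset.univ.image g := by
      intro y hy
      simp only [Finset.mem_insert, Finset.mem_erase, Finset.mem_image, Finset.mem_univ,
        true_and] at hy ⊢
      rcases hy with rfl | ⟨hy, v, rfl⟩
      · exact ⟨_, hg0⟩
      · exact ⟨v, hgne v fun hv => hy (by rw [hv])⟩
    have h1 := Finset.card_le_card hsub
    rw [Finset.card_insert_of_notMem fun h => hunot (Finset.mem_of_mem_erase h),
      Finset.card_erase_add_one (Finset.mem_image_of_mem f (Finset.mem_univ _))] at h1
    exact h1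
  have hjs : ∀ t < k + 1, js (t + 1) ≠ js 0 := fun t ht => hrep t ht
  have hw0 : w ≠ js 0 := by
    rintro rfl
    exact hjs k (by omega) (huniq _ hw.symm)
  refine ih k (by omega) g (f (js 0)) (fun t => js (t + 1)) hRg
    (fun h hh => (hmax h hh).trans hcard) ?_ (hstep 0 (by omega)) ?_ ?_
  · intro v
    by_cases hv : v = js 0
    · rw [hv, hg0]; exact (hu _).symm
    · rw [hgne v hv]; exact fun h => hv (huniq v h)
  · intro t ht
    rw [hgne _ (hjs t (by omega))]
    exact hstep (t + 1) (by omega)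
  · rw [hgne _ hw0, hgne _ (hjs k (by omega))]
    exact hw

/-- A tilde-valid arc subset is the graph of a parent map. -/
theorem TildeValid.exists_parent {n m : ℕ} {σ σ' : Fin n → Fin m}
    {At : Finset (Fin m × Fin m)} (h : TildeValid σ σ' At) :
    ∃ f : Fin m → Fin m, ∀ u v, (u, v) ∈ At ↔ f v = u := by
  have key : ∀ v, ∃ a, ∀ u, (u, v) ∈ At ↔ a = u := by
    intro v
    obtain ⟨⟨a, b⟩, hab⟩ := Finset.card_eq_one.mp (h.2 v)
    have hmem : ∀ x y, ((x, y) ∈ At ∧ y = v) ↔ (x = a ∧ y = b) := fun x y => by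
      simpa using Finset.ext_iff.mp hab (x, y)
    have hb : b = v := ((hmem a b).mpr ⟨rfl, rfl⟩).2
    refine ⟨a, fun u => ?_⟩
    have := hmem u v
    simp only [and_true, hb] at this
    rw [this, eq_comm]
  choose f hf using key
  exact ⟨f, fun u v => hf v u⟩

/-- If `f` is the parent map of `At`, then out-degrees count the fibres of `f`. -/
theorem outDeg_eq_card_fiber {m : ℕ} {At : Finset (Fin m × Fin m)} {f : Fin m → Fin m}
    (hf : ∀ u v, (u, v) ∈ At ↔ f v = u) (i : Fin m) :
    outDeg At i = (Finset.univ.filter fun v => f v = i).card := by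
  rw [outDeg, ← Finset.card_image_of_injective (Finset.univ.filter fun v => f v = i)
    (Prod.mk_right_injective i)]
  congr 1
  ext ⟨x, y⟩
  simp only [Finset.mem_filter, Finset.mem_image, Finset.mem_univ, true_and, Prod.mk.injEq, hf]
  constructor
  · rintro ⟨h, rfl⟩
    exact ⟨y, h, rfl, rfl⟩
  · rintro ⟨v, h, rfl, rfl⟩
    exact ⟨h, rfl⟩

/-- If `f` is the parent map of `At`, then `W₀` is the complement of the image of `f`. -/
theorem W0_eq_compl_image {m : ℕ} {At : Finset (Fin m × Fin m)} {f : Fin m → Fin m}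
    (hf : ∀ u v, (u, v) ∈ At ↔ f v = u) : W0 At = (Finset.univ.image f)ᶜ := by
  ext i
  simp [W0, outDeg_eq_card_fiber hf, Finset.filter_eq_empty_iff]

/-- Any map sending each server to an in-neighbour yields a tilde-valid arc subset. -/
theorem tildeValid_image {n m : ℕ} {σ σ' : Fin n → Fin m} {g : Fin m → Fin m}
    (hg : ∀ v, Arc σ σ' (g v) v) :
    TildeValid σ σ' (Finset.univ.image fun v => (g v, v)) := by
  refine ⟨?_, fun i => Finset.card_eq_one.mpr ⟨(g i, i), ?_⟩⟩
  · simpa using hg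
  · ext ⟨x, y⟩
    simp only [Finset.mem_filter, Finset.mem_image, Finset.mem_univ, true_and, Prod.mk.injEq,
      Finset.mem_singleton]
    constructor
    · rintro ⟨⟨v, rfl, rfl⟩, rfl⟩
      exact ⟨rfl, rfl⟩
    · rintro ⟨rfl, rfl⟩
      exact ⟨⟨y, rfl, rfl⟩, rfl⟩

/-- Under Assumption 1 the parent map has an image of maximum size. -/
theorem Assumption1.card_image_le {n m : ℕ} {σ σ' : Fin n → Fin m}
    {At : Finset (Fin m × Fin m)} (hA : Assumption1 σ σ' At) {f : Fin m → Fin m}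
    (hf : ∀ u v, (u, v) ∈ At ↔ f v = u) (g : Fin m → Fin m) (hg : ∀ v, Arc σ σ' (g v) v) :
    (Finset.univ.image g).card ≤ (Finset.univ.image f).card := by
  have h := hA.2 _ (tildeValid_image hg)
  rw [W0_eq_compl_image hf, W0_eq_compl_image (f := g) (by simp), Finset.card_compl,
    Finset.card_compl] at h
  have := Finset.card_le_univ (Finset.univ.image g)
  have := Finset.card_le_univ (Finset.univ.image f)
  omega

/-- The alternating path witnessing an association can be prolonged by one step. -/
theorem AssociatedW0.extend {n m : ℕ} {σ σ' : Fin n → Fin m}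
    {At : Finset (Fin m × Fin m)} {u v w : Fin m} (hu : AssociatedW0 σ σ' At u)
    (huv : Arc σ σ' u v) (hwv : (w, v) ∈ At) : AssociatedW0 σ σ' At w := by
  obtain ⟨k, is, js, rfl, hstart, hAt, hstep⟩ := hu
  refine ⟨k + 1, fun t => if t ≤ k then is t else w, fun t => if t ≤ k then js t else v,
    by simp, by simpa using hstart, fun t ht => ?_, fun t ht => ?_⟩
  · by_cases h : t ≤ k
    · simpa [h] using hAt t h
    · simpa [h] using hwv
  · have htk : t ≤ k := by omega
    by_cases h : t + 1 ≤ k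
    · simpa [htk, h] using hstep t h
    · obtain rfl : t = k := by omega
      simpa using huv

/-- For a minimal coalitional deviation from an NE involving all `m` servers
and an arc subset `At` satisfying Assumption 1: every server of `W₁` has
out-degree `1` in `At`, and the set of `A`-out-neighbours of `W₀ ∪ W₁` is
exactly `W̃₁`. -/
theorem W1_outdeg_one_and_out_neighbours {n m : ℕ}
    (p : Fin n → ℝ) (hp : ∀ j, 0 < p j)
    (σ : Fin n → Fin m) (hNE : IsNE p σ)
    (σ' : Fin n → Fin m) (hmin : IsMinimalDeviation p σ σ')
    (hall : ∀ i, Participates σ σ' i)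
    (At : Finset (Fin m × Fin m)) (hA : Assumption1 σ σ' At) :
    (∀ i ∈ W1 σ σ' At, outDeg At i = 1) ∧
      {v : Fin m | ∃ u, (u ∈ W0 At ∨ u ∈ W1 σ σ' At) ∧ Arc σ σ' u v}
        = ↑(W1t σ σ' At) := by
  obtain ⟨f, hf⟩ := hA.1.exists_parent
  have hfArc : ∀ v, Arc σ σ' (f v) v := fun v => hA.1.1 _ ((hf _ v).mpr rfl)
  refine ⟨fun i hi => ?_, Set.ext fun v => ?_⟩
  · obtain ⟨k, is, js, rfl, ⟨u, hu, hstart⟩, hAt, hstep⟩ := (Finset.mem_filter.mp hi).2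
    have hfis : ∀ t ≤ k, f (js t) = is t := fun t ht => (hf _ _).mp (hAt t ht)
    have hu' : ∀ v, f v ≠ u := by
      simpa [W0_eq_compl_image hf] using hu
    rw [outDeg_eq_card_fiber hf, Finset.card_eq_one]
    refine ⟨js k, Finset.ext fun w => ?_⟩
    simp only [Finset.mem_filter, Finset.mem_univ, true_and, Finset.mem_singleton]
    refine ⟨fun hw => ?_, fun hw => by rw [hw, hfis k le_rfl]⟩
    exact eq_of_parent_eq_of_alternating_path k f u js hfArc (hA.card_image_le hf) hu' hstart
      (fun t ht => by rw [hfis t ht.le]; exact hstep t ht) w (by rw [hw, hfis k le_rfl])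
  · have hmem : (f v, v) ∈ At := (hf _ v).mpr rfl
    simp only [Set.mem_ofPred_eq, W1t, W1, Finset.coe_filter, Finset.mem_filter,
      Finset.mem_univ, true_and]
    constructor
    · rintro ⟨u, hu | hu, huv⟩
      · exact ⟨f v, ⟨0, fun _ => f v, fun _ => v, rfl, ⟨u, hu, huv⟩, fun _ _ => hmem,
          by simp⟩, hmem⟩
      · exact ⟨f v, hu.extend huv hmem, hmem⟩
    · rintro ⟨u, hu, huv⟩
      exact ⟨u, Or.inr hu, hA.1.1 _ huv⟩
end

section
/- Let m ≥ 3 and let m_a^b (for integers 2 ≤ a ≤ m and 0 ≤ b ≤ a) be nonnegative integers satisfying Σ_{a=2}^m Σ_{b=0}^a m_a^b = m and Σ_{a=2}^m Σ_{b=0}^a b·m_a^b = m. If m_2^2 + (1/2)·m_3^3 ≤ Σ_{a=2}^m m_a^1 + (1/2)·m_3^2 + Σ_{a=4}^m Σ_{b=2}^a (b − (4b−5)/(a−1))·m_a^b, then (Σ_{a=2}^m Σ_{b=2}^a (b/(a−1))·m_a^b + m) / (Σ_{a=2}^m Σ_{b=2}^a (1/(a−1))·m_a^b + m) ≤ 5/4.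 -/
/-- The first moment of a family on `{0, …, a}` is its value at `1` plus the part from `2` on. -/
lemma sum_range_succ_natCast_mul_eq (f : ℕ → ℚ) {a : ℕ} (ha : 1 ≤ a) :
    ∑ b ∈ Finset.range (a + 1), (b : ℚ) * f b = f 1 + ∑ b ∈ Finset.Icc 2 a, (b : ℚ) * f b := by
  have h : Finset.range (a + 1) = insert 0 (insert 1 (Finset.Icc 2 a)) := by
    ext x
    simp only [Finset.mem_range, Finset.mem_insert, Finset.mem_Icc]
    omega
  rw [h, Finset.sum_insert (by simp), Finset.sum_insert (by simp)]
  simp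

/-- Splitting off the first two terms of a sum over `{2, …, m}`. -/
lemma sum_Icc_two_eq_add_add (f : ℕ → ℚ) {m : ℕ} (hm : 3 ≤ m) :
    ∑ a ∈ Finset.Icc 2 m, f a = f 2 + f 3 + ∑ a ∈ Finset.Icc 4 m, f a := by
  have h : Finset.Icc 2 m = insert 2 (insert 3 (Finset.Icc 4 m)) := by
    ext x
    simp only [Finset.mem_insert, Finset.mem_Icc]
    omega
  rw [h, Finset.sum_insert (by simp), Finset.sum_insert (by simp), add_assoc]


/-- The purely arithmetic inequality behind the `5/4` bound: if the
nonnegative integers `m_a^b` (for `2 ≤ a ≤ m`, `0 ≤ b ≤ a`) satisfy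
`Σ m_a^b = m`, `Σ b·m_a^b = m` and the key inequality, then the load ratio
is at most `5/4`. -/
theorem key_arithmetic_inequality (m : ℕ) (hm : 3 ≤ m) (mab : ℕ → ℕ → ℕ)
    (h1 : ∑ a ∈ Finset.Icc 2 m, ∑ b ∈ Finset.range (a + 1), mab a b = m)
    (h2 : ∑ a ∈ Finset.Icc 2 m, ∑ b ∈ Finset.range (a + 1), b * mab a b = m)
    (h3 : (mab 2 2 : ℚ) + (1 / 2) * mab 3 3 ≤
        (∑ a ∈ Finset.Icc 2 m, (mab a 1 : ℚ)) + (1 / 2) * mab 3 2 +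
          ∑ a ∈ Finset.Icc 4 m, ∑ b ∈ Finset.Icc 2 a,
            ((b : ℚ) - (4 * (b : ℚ) - 5) / ((a : ℚ) - 1)) * mab a b) :
    ((∑ a ∈ Finset.Icc 2 m, ∑ b ∈ Finset.Icc 2 a,
          ((b : ℚ) / ((a : ℚ) - 1)) * mab a b) + m) /
        ((∑ a ∈ Finset.Icc 2 m, ∑ b ∈ Finset.Icc 2 a,
          (1 / ((a : ℚ) - 1)) * mab a b) + m) ≤ 5 / 4 := by
  have hmoment : (∑ a ∈ Finset.Icc 2 m, (mab a 1 : ℚ)) +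
      ∑ a ∈ Finset.Icc 2 m, ∑ b ∈ Finset.Icc 2 a, (b : ℚ) * mab a b = m := by
    rw [← Finset.sum_add_distrib]
    have h2' : ∑ a ∈ Finset.Icc 2 m, ∑ b ∈ Finset.range (a + 1), (b : ℚ) * mab a b = m := by
      exact_mod_cast h2
    rw [← h2']
    refine Finset.sum_congr rfl fun a ha => ?_
    rw [sum_range_succ_natCast_mul_eq (fun b => (mab a b : ℚ))
      (by have := (Finset.mem_Icc.mp ha).1; omega)]
  have hsplit := sum_Icc_two_eq_add_add (fun a => ∑ b ∈ Finset.Icc 2 a,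
    ((b : ℚ) - (4 * (b : ℚ) - 5) / ((a : ℚ) - 1)) * mab a b) hm
  have h22 : Finset.Icc 2 2 = {2} := rfl
  have h23 : Finset.Icc 2 3 = {2, 3} := rfl
  have hexpand : ∑ a ∈ Finset.Icc 2 m, ∑ b ∈ Finset.Icc 2 a,
        ((b : ℚ) - (4 * (b : ℚ) - 5) / ((a : ℚ) - 1)) * mab a b =
      (∑ a ∈ Finset.Icc 2 m, ∑ b ∈ Finset.Icc 2 a, (b : ℚ) * mab a b) -
        4 * (∑ a ∈ Finset.Icc 2 m, ∑ b ∈ Finset.Icc 2 a, ((b : ℚ) / ((a : ℚ) - 1)) * mab a b) +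
        5 * ∑ a ∈ Finset.Icc 2 m, ∑ b ∈ Finset.Icc 2 a, (1 / ((a : ℚ) - 1)) * mab a b := by
    simp only [Finset.mul_sum, ← Finset.sum_sub_distrib, ← Finset.sum_add_distrib]
    refine Finset.sum_congr rfl fun a _ => Finset.sum_congr rfl fun b _ => ?_
    ring
  have hnonneg : 0 ≤ ∑ a ∈ Finset.Icc 2 m, ∑ b ∈ Finset.Icc 2 a,
      (1 / ((a : ℚ) - 1)) * mab a b := by
    refine Finset.sum_nonneg fun a ha => Finset.sum_nonneg fun b _ => ?_
    have ha' : (2 : ℚ) ≤ a := by exact_mod_cast (Finset.mem_Icc.mp ha).1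
    have : (0 : ℚ) ≤ (a : ℚ) - 1 := by linarith
    positivity
  have hm' : (3 : ℚ) ≤ m := by exact_mod_cast hm
  rw [div_le_iff₀ (by linarith)]
  rw [hexpand, h22, h23, Finset.sum_singleton, Finset.sum_pair (by norm_num)] at hsplit
  norm_num at hsplit h3 hmoment hnonneg ⊢
  linarith
end

section
/- Let m ≥ 2, and for i = 1,…,m let a_i be integers with 2 ≤ a_i ≤ m, let b_i be nonnegative integers with Σ_{i=1}^m b_i = m, and let L_i be real numbers with 1 ≤ L_i ≤ a_i/(a_i − 1). If (Σ_i b_i L_i)/(Σ_i L_i) ≥ 1, then (Σ_i b_i L_i)/(Σ_i L_i) ≤ (Σ_{i : b_i ≥ 2} (a_i b_i/(a_i − 1)) + |{i : b_i = 1}|) / (Σ_{i : b_i ≥ 2} (a_i/(a_i − 1)) + |{i : b_i = 1}| + |{i : b_i = 0}|). -/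
/-- The extremal adjustment step: for `m ≥ 2`, integers `2 ≤ a_i ≤ m`,
nonnegative integers `b_i` with `Σ b_i = m`, and reals `1 ≤ L_i ≤ a_i/(a_i−1)`,
if the ratio `(Σ b_i L_i)/(Σ L_i)` is at least `1`, then it is at most the value
obtained by setting `L_i = a_i/(a_i−1)` when `b_i ≥ 2` and `L_i = 1` when
`b_i ≤ 1`. -/
theorem load_ratio_extremal_adjustment (m : ℕ) (hm : 2 ≤ m)
    (a b : Fin m → ℕ) (ha : ∀ i, 2 ≤ a i ∧ a i ≤ m) (hb : ∑ i, b i = m)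
    (L : Fin m → ℝ) (hL : ∀ i, 1 ≤ L i ∧ L i ≤ (a i : ℝ) / ((a i : ℝ) - 1))
    (hr : 1 ≤ (∑ i, (b i : ℝ) * L i) / (∑ i, L i)) :
    (∑ i, (b i : ℝ) * L i) / (∑ i, L i) ≤
      ((∑ i ∈ Finset.univ.filter (fun i => 2 ≤ b i),
            (a i : ℝ) * (b i : ℝ) / ((a i : ℝ) - 1)) +
          ((Finset.univ.filter (fun i => b i = 1)).card : ℝ)) /
        ((∑ i ∈ Finset.univ.filter (fun i => 2 ≤ b i),
            (a i : ℝ) / ((a i : ℝ) - 1)) +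
          ((Finset.univ.filter (fun i => b i = 1)).card : ℝ) +
          ((Finset.univ.filter (fun i => b i = 0)).card : ℝ)) := by
  have hdiv : ∀ i, (a i : ℝ) / ((a i : ℝ) - 1) ≤ 2 := fun i => by
    have h : (2 : ℝ) ≤ a i := by exact_mod_cast (ha i).1
    rw [div_le_iff₀ (by linarith)]
    linarith
  set M : Fin m → ℝ := fun i => if 2 ≤ b i then (a i : ℝ) / ((a i : ℝ) - 1) else 1 with hM
  have hnum : (∑ i ∈ Finset.univ.filter (fun i => 2 ≤ b i),
        (a i : ℝ) * (b i : ℝ) / ((a i : ℝ) - 1)) +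
      ((Finset.univ.filter (fun i => b i = 1)).card : ℝ) = ∑ i, (b i : ℝ) * M i := by
    rw [Finset.sum_filter, ← Finset.sum_boole, ← Finset.sum_add_distrib]
    refine Finset.sum_congr rfl fun i _ => ?_
    rcases (by omega : b i = 0 ∨ b i = 1 ∨ 2 ≤ b i) with h | h | h
    · simp [hM, h]
    · simp [hM, h]
    · simp only [hM, h, if_true, show b i ≠ 1 by omega, if_false]
      ring
  have hden : (∑ i ∈ Finset.univ.filter (fun i => 2 ≤ b i), (a i : ℝ) / ((a i : ℝ) - 1)) +
      ((Finset.univ.filter (fun i => b i = 1)).card : ℝ) +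
      ((Finset.univ.filter (fun i => b i = 0)).card : ℝ) = ∑ i, M i := by
    rw [Finset.sum_filter, ← Finset.sum_boole, ← Finset.sum_boole, ← Finset.sum_add_distrib,
      ← Finset.sum_add_distrib]
    refine Finset.sum_congr rfl fun i _ => ?_
    rcases (by omega : b i = 0 ∨ b i = 1 ∨ 2 ≤ b i) with h | h | h
    · simp [hM, h]
    · simp [hM, h]
    · simp [hM, h, show b i ≠ 1 by omega, show b i ≠ 0 by omega]
  rw [hnum, hden]
  have sum_ge : ∀ f : Fin m → ℝ, (∀ i, 1 ≤ f i) → (m : ℝ) ≤ ∑ i, f i := fun f hf => by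
    simpa using Finset.sum_le_sum fun i (_ : i ∈ Finset.univ) => hf i
  have hm0 : (0 : ℝ) < m := by exact_mod_cast (by omega : 0 < m)
  have hLm := sum_ge L fun i => (hL i).1
  have hMm := sum_ge M fun i => by
    simp only [hM]
    split_ifs
    · exact (hL i).1.trans (hL i).2
    · exact le_rfl
  have hL0 : 0 < ∑ i, L i := hm0.trans_le hLm
  have hr2 : (∑ i, (b i : ℝ) * L i) / (∑ i, L i) ≤ 2 := by
    rw [div_le_iff₀ hL0]
    have h : ∑ i, (b i : ℝ) * L i ≤ ∑ i, (b i : ℝ) * 2 := Finset.sum_le_sum fun i _ =>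
      mul_le_mul_of_nonneg_left ((hL i).2.trans (hdiv i)) (Nat.cast_nonneg _)
    rw [← Finset.sum_mul, ← Nat.cast_sum, hb] at h
    linarith
  have hrL := div_mul_cancel₀ (∑ i, (b i : ℝ) * L i) hL0.ne'
  generalize (∑ i, (b i : ℝ) * L i) / (∑ i, L i) = r at hr hr2 hrL ⊢
  have hadj : ∑ i, ((b i : ℝ) - r) * L i ≤ ∑ i, ((b i : ℝ) - r) * M i := by
    refine Finset.sum_le_sum fun i _ => ?_
    by_cases h : 2 ≤ b i
    · have hb2 : (2 : ℝ) ≤ b i := by exact_mod_cast h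
      simp only [hM, h, if_true]
      exact mul_le_mul_of_nonneg_left (hL i).2 (by linarith)
    · have hb1 : (b i : ℝ) ≤ 1 := by exact_mod_cast (by omega : b i ≤ 1)
      simp only [hM, h, if_false]
      exact mul_le_mul_of_nonpos_left (hL i).1 (by linarith)
  simp only [sub_mul, Finset.sum_sub_distrib, ← Finset.mul_sum] at hadj
  rw [le_div_iff₀ (hm0.trans_le hMm)]
  linarith
end
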